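/- Assume Hypothesis (H1), let β ≥ 0, and let y be a classical solution of the damped degenerate wave equation. Then for every T > s > 0, with Q_s = (s,T)×(0,1), the following identity holds: 0 = 2∫_0^1 [x y_x y_t/σ]_{t=s}^{t=T} dx − (1/σ(1)) ∫_s^T y_t(t,1)² dt − η(1) ∫_s^T y_x(t,1)² dt − ∫∫_{Q_s} x η (b/a) y_x² dx dt + ∫∫_{Q_s} (1 − x(a'−b)/a) (1/σ) y_t² dx dt + ∫∫_{Q_s} η y_x² dx dt. -/

import Mathlib

open MeasureTheory Set Filter Topology

/-- The Feller weight `η(x) = exp (∫_{1/2}^x b/a)`. -/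
noncomputable def etaW (a b : ℝ → ℝ) (x : ℝ) : ℝ :=
  Real.exp (∫ s in (1/2 : ℝ)..x, b s / a s)

/-- The weight `σ = a / η`. -/
noncomputable def sigW (a b : ℝ → ℝ) (x : ℝ) : ℝ :=
  a x / etaW a b x

/-- `u ∈ H¹(0,1)` with (a.e.) derivative `u'`. -/
structure MemH1 (u u' : ℝ → ℝ) : Prop where
  cont : ContinuousOn u (Set.Icc 0 1)
  hasDeriv : ∀ᵐ x ∂(volume.restrict (Set.Ioo (0:ℝ) 1)), HasDerivAt u (u' x) x
  deriv_sq_int : IntegrableOn (fun x => (u' x) ^ 2) (Set.Ioo (0:ℝ) 1)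
  ftc : ∀ x ∈ Set.Icc (0:ℝ) 1, u x = u 0 + ∫ t in Set.Ioo (0:ℝ) x, u' t

/-- `u ∈ L²_{1/σ}(0,1)`. -/
def MemL2sig (a b u : ℝ → ℝ) : Prop :=
  IntegrableOn (fun x => (u x) ^ 2) (Set.Ioo (0:ℝ) 1) ∧
  IntegrableOn (fun x => (u x) ^ 2 / sigW a b x) (Set.Ioo (0:ℝ) 1)

/-- `u ∈ H¹_{1/σ}(0,1)`. -/
structure MemH1sig (a b u u' : ℝ → ℝ) extends MemH1 u u' : Prop where
  l2sig : MemL2sig a b u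

/-- `u ∈ H¹_{1/σ,0}(0,1)`. -/
structure MemH1sig0 (a b u u' : ℝ → ℝ) extends MemH1sig a b u u' : Prop where
  zero : u 0 = 0

/-- `u ∈ H²_{1/σ}(0,1)`: `η u'` is locally absolutely continuous on `(0,1]`
with derivative `w`, and `Au = σ (η u')' = σ w ∈ L²_{1/σ}`. -/
structure MemH2sig (a b u u' w : ℝ → ℝ) extends MemH1sig a b u u' : Prop where
  w_locint : ∀ c ∈ Set.Ioc (0:ℝ) 1, IntegrableOn w (Set.Icc c 1)
  locAC : ∀ c ∈ Set.Ioc (0:ℝ) 1, ∀ x ∈ Set.Icc c 1,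
    etaW a b x * u' x = etaW a b c * u' c + ∫ t in Set.Ioo c x, w t
  Au_l2sig : MemL2sig a b (fun x => sigW a b x * w x)

/-- `u ∈ H²_{1/σ,0}(0,1)`. -/
structure MemH2sig0 (a b u u' w : ℝ → ℝ) extends MemH2sig a b u u' w : Prop where
  zero : u 0 = 0

/-- Hypothesis (H0): there is `K > 0` such that `x ↦ x^K / a x` is nondecreasing
in a right neighborhood of `0`. -/
def HypH0K (a : ℝ → ℝ) (K : ℝ) : Prop :=
  0 < K ∧ ∃ ε > (0:ℝ), ∀ x y : ℝ, 0 < x → x ≤ y → y ≤ ε →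
    x ^ K / a x ≤ y ^ K / a y

def HypH0 (a : ℝ → ℝ) : Prop := ∃ K : ℝ, HypH0K a K

/-- `a` is weakly degenerate at `0` with constant
`K = sup_{x ∈ (0,1]} x|a'(x)|/a(x) ∈ (0,1)`. -/
def IsWD (a a' : ℝ → ℝ) (K : ℝ) : Prop :=
  ContinuousOn a (Set.Icc 0 1) ∧ a 0 = 0 ∧ (∀ x ∈ Set.Ioc (0:ℝ) 1, 0 < a x) ∧
  (∀ x ∈ Set.Ioc (0:ℝ) 1, HasDerivAt a (a' x) x) ∧
  ContinuousOn a' (Set.Ioc 0 1) ∧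
  IsLUB ((fun x => x * |a' x| / a x) '' Set.Ioc (0:ℝ) 1) K ∧ 0 < K ∧ K < 1

/-- `a` is strongly degenerate at `0` with constant
`K = sup_{x ∈ (0,1]} x|a'(x)|/a(x) ∈ [1,2)`. -/
def IsSD (a a' : ℝ → ℝ) (K : ℝ) : Prop :=
  ContinuousOn a (Set.Icc 0 1) ∧ a 0 = 0 ∧ (∀ x ∈ Set.Ioc (0:ℝ) 1, 0 < a x) ∧
  (∀ x ∈ Set.Icc (0:ℝ) 1, HasDerivWithinAt a (a' x) (Set.Icc 0 1) x) ∧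
  ContinuousOn a' (Set.Icc 0 1) ∧
  IsLUB ((fun x => x * |a' x| / a x) '' Set.Ioc (0:ℝ) 1) K ∧ 1 ≤ K ∧ K < 2

/-- Hypothesis (H1): `b/a ∈ L¹(0,1)`, `b` continuous, `a` is (WD) or (SD) with
constant `K`, and if `K > 1` then `x b(x)/a(x) ∈ L^∞(0,1)`. -/
def HypH1 (a a' b : ℝ → ℝ) (K : ℝ) : Prop :=
  (IsWD a a' K ∨ IsSD a a' K) ∧ ContinuousOn b (Set.Icc 0 1) ∧
  MeasureTheory.IntegrableOn (fun x => b x / a x) (Set.Ioo (0:ℝ) 1) ∧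
  (1 < K → ∃ M : ℝ, ∀ x ∈ Set.Ioo (0:ℝ) 1, |x * b x / a x| ≤ M)

/-- Hypothesis (H2): (H1) and `(2-K) a(x) - 2x|b(x)| ≥ ε₀ a(x)` on `[0,1]`. -/
def HypH2 (a a' b : ℝ → ℝ) (K ε₀ : ℝ) : Prop :=
  HypH1 a a' b K ∧ 0 < ε₀ ∧
  ∀ x ∈ Set.Icc (0:ℝ) 1, ε₀ * a x ≤ (2 - K) * a x - 2 * x * |b x|

/-- A classical solution of the damped degenerate wave equation
`y_tt = a y_xx + b y_x`, `y(t,0) = 0`, `y_t(t,1) + η(1) y_x(t,1) + β y(t,1) = 0`,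
with the regularity, integrability and differentiation-under-the-integral
properties required of classical solutions. -/
structure ClassicalSol (a b : ℝ → ℝ) (β : ℝ)
    (y yt yx ytt ytx yxx : ℝ → ℝ → ℝ) : Prop where
  dt : ∀ t x, 0 ≤ t → x ∈ Set.Icc (0:ℝ) 1 → HasDerivAt (fun s => y s x) (yt t x) t
  dtt : ∀ t x, 0 ≤ t → x ∈ Set.Icc (0:ℝ) 1 → HasDerivAt (fun s => yt s x) (ytt t x) t
  dx : ∀ t x, 0 ≤ t → x ∈ Set.Ioc (0:ℝ) 1 → HasDerivAt (fun ξ => y t ξ) (yx t x) x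
  dtx : ∀ t x, 0 ≤ t → x ∈ Set.Ioc (0:ℝ) 1 → HasDerivAt (fun ξ => yt t ξ) (ytx t x) x
  dxx : ∀ t x, 0 ≤ t → x ∈ Set.Ioc (0:ℝ) 1 → HasDerivAt (fun ξ => yx t ξ) (yxx t x) x
  cont_tt : ContinuousOn (Function.uncurry ytt) (Set.Ici 0 ×ˢ Set.Ioc (0:ℝ) 1)
  cont_tx : ContinuousOn (Function.uncurry ytx) (Set.Ici 0 ×ˢ Set.Ioc (0:ℝ) 1)
  cont_xx : ContinuousOn (Function.uncurry yxx) (Set.Ici 0 ×ˢ Set.Ioc (0:ℝ) 1)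
  pde : ∀ t x, 0 < t → x ∈ Set.Ioo (0:ℝ) 1 → ytt t x = a x * yxx t x + b x * yx t x
  bc0 : ∀ t, 0 ≤ t → y t 0 = 0
  bc1 : ∀ t, 0 < t → yt t 1 + etaW a b 1 * yx t 1 + β * y t 1 = 0
  regx : ∀ t, 0 ≤ t → MemH2sig0 a b (y t) (yx t)
    (fun x => etaW a b x * (b x / a x * yx t x + yxx t x))
  regt : ∀ t, 0 ≤ t → MemH1sig0 a b (yt t) (ytx t)
  ediff : ∀ t, 0 ≤ t → HasDerivAt
    (fun s => ∫ x in Set.Ioo (0:ℝ) 1,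
      ((yt s x) ^ 2 / sigW a b x + etaW a b x * (yx s x) ^ 2))
    (∫ x in Set.Ioo (0:ℝ) 1,
      (2 * yt t x * ytt t x / sigW a b x + 2 * etaW a b x * yx t x * ytx t x)) t
  intQ : ∀ s T : ℝ, 0 < s → s < T →
    MeasureTheory.IntegrableOn
      (fun p : ℝ × ℝ => (yt p.1 p.2) ^ 2 / sigW a b p.2)
      (Set.Ioo s T ×ˢ Set.Ioo (0:ℝ) 1) ∧
    MeasureTheory.IntegrableOn
      (fun p : ℝ × ℝ => etaW a b p.2 * (yx p.1 p.2) ^ 2)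
      (Set.Ioo s T ×ˢ Set.Ioo (0:ℝ) 1)
  intBdry : ∀ s T : ℝ, 0 < s → s < T →
    MeasureTheory.IntegrableOn (fun t => (yt t 1) ^ 2) (Set.Ioo s T) ∧
    MeasureTheory.IntegrableOn (fun t => (yx t 1) ^ 2) (Set.Ioo s T) ∧
    MeasureTheory.IntegrableOn (fun t => (y t 1) ^ 2) (Set.Ioo s T)

/-- The energy of a solution `y`:
`E_y(t) = (1/2) [∫₀¹ (y_t²/σ + η y_x²) dx + β y(t,1)²]`. -/
noncomputable def energy (a b : ℝ → ℝ) (β : ℝ) (y yt yx : ℝ → ℝ → ℝ) (t : ℝ) : ℝ :=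
  (1/2) * ((∫ x in Set.Ioo (0:ℝ) 1,
    ((yt t x) ^ 2 / sigW a b x + etaW a b x * (yx t x) ^ 2)) + β * (y t 1) ^ 2)

theorem eq_setIntegral_of_integrableOn_div {h q : ℝ → ℝ} (hc : ContinuousOn h (Ioc 0 1))
    (hd : ∀ x ∈ Ioo (0:ℝ) 1, HasDerivAt h (q x) x) (hq : IntegrableOn q (Ioo 0 1))
    (hx : IntegrableOn (fun x => h x / x) (Ioo 0 1)) :
    h 1 = ∫ x in Ioo (0:ℝ) 1, q x := by
  have hqI : IntegrableOn q (uIcc 0 1) := by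
    rw [uIcc_of_le zero_le_one]
    rwa [integrableOn_Icc_iff_integrableOn_Ioo]
  have hqi : IntervalIntegrable q volume 0 1 := hqI.intervalIntegrable
  have key : ∀ x ∈ Ioc (0:ℝ) 1, h x = h 1 - ∫ t in x..1, q t := by
    intro x hx
    have := intervalIntegral.integral_eq_sub_of_hasDerivAt_of_le hx.2
      (hc.mono fun z hz => ⟨hx.1.trans_le hz.1, hz.2⟩)
      (fun z hz => hd z ⟨hx.1.trans hz.1, hz.2⟩)
      (hqi.mono_set (by
        rw [uIcc_of_le hx.2, uIcc_of_le zero_le_one]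
        exact Icc_subset_Icc_left hx.1.le))
    linarith
  have hlim : Tendsto h (𝓝[>] 0) (𝓝 (h 1 - ∫ t in (0:ℝ)..1, q t)) := by
    have h1 := (intervalIntegral.continuousOn_primitive_interval_left hqI) 0 left_mem_uIcc
    rw [uIcc_of_le zero_le_one] at h1
    have h2 := (h1.mono_left (nhdsWithin_mono 0 Ioc_subset_Icc_self)).const_sub (h 1)
    rw [nhdsWithin_Ioc_eq_nhdsGT one_pos] at h2
    refine h2.congr' ?_
    filter_upwards [Ioc_mem_nhdsGT (one_pos : (0:ℝ) < 1)] with x hx using (key x hx).symm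
  rw [← integral_Ioc_eq_integral_Ioo, ← intervalIntegral.integral_of_le zero_le_one]
  by_contra hne
  set L := h 1 - ∫ t in (0:ℝ)..1, q t with hL
  have hL0 : 0 < |L| := abs_pos.mpr (sub_ne_zero.mpr hne)
  have hev : ∀ᶠ x in 𝓝[>] (0:ℝ), |L| / 2 < |h x| :=
    hlim.abs.eventually_const_lt (half_lt_self hL0)
  obtain ⟨δ, hδ, hsub⟩ := mem_nhdsGT_iff_exists_Ioo_subset.mp
    (hev.and (Ioo_mem_nhdsGT (one_pos : (0:ℝ) < 1)))
  have hδ' : (0:ℝ) < δ := hδ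
  have hint : IntegrableOn (fun x : ℝ => x⁻¹) (Ioo 0 δ) := by
    have h1 : IntegrableOn (fun x => (2 / |L|) * (h x / x)) (Ioo 0 δ) :=
      (hx.mono_set fun x hx => (hsub hx).2).const_mul _
    refine Integrable.mono h1 measurable_inv.aestronglyMeasurable ?_
    refine (ae_restrict_iff' measurableSet_Ioo).mpr (Eventually.of_forall fun x hx => ?_)
    have h2 : |L| / 2 < |h x| := (hsub hx).1
    simp only [norm_mul, norm_div, norm_inv, Real.norm_eq_abs, abs_abs, abs_two, abs_of_pos hx.1]
    have hx1 : 0 < x := hx.1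
    rw [show 2 / |L| * (|h x| / x) = (|h x| / (|L| / 2)) * x⁻¹ by field_simp]
    refine le_mul_of_one_le_left (inv_pos.mpr hx1).le ?_
    rw [one_le_div (by positivity)]
    exact h2.le
  have h3 : IntervalIntegrable (fun x : ℝ => x⁻¹) volume 0 δ :=
    (intervalIntegrable_iff_integrableOn_Ioo_of_le hδ'.le).mpr hint
  rw [intervalIntegrable_inv_iff] at h3
  rcases h3 with h3 | h3
  · exact hδ'.ne h3
  · exact h3 left_mem_uIcc

section Parametric

variable {s T : ℝ} {f f' : ℝ → ℝ → ℝ}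

theorem continuousOn_uncurry_of_hasDerivAt
    (hf : ∀ t ∈ Icc s T, ∀ x ∈ Ioc (0:ℝ) 1, HasDerivAt (f t) (f' t x) x)
    (hf' : ContinuousOn (Function.uncurry f') (Icc s T ×ˢ Ioc (0:ℝ) 1))
    (hc : ∀ x ∈ Ioo (0:ℝ) 1, ContinuousOn (fun t => f t x) (Icc s T)) :
    ContinuousOn (Function.uncurry f) (Icc s T ×ˢ Ioc (0:ℝ) 1) := by
  have key : ∀ c ∈ Ioo (0:ℝ) 1, ContinuousOn (Function.uncurry f) (Icc s T ×ˢ Icc c 1) := by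
    intro c hc0
    have hsub : Icc c 1 ⊆ Ioc (0:ℝ) 1 := fun z hz => ⟨hc0.1.trans_le hz.1, hz.2⟩
    obtain ⟨M, hM⟩ := (isCompact_Icc.prod isCompact_Icc).exists_bound_of_continuousOn
      (hf'.mono (prod_mono_right hsub))
    refine continuousOn_prod_of_subset_closure_continuousOn_lipschitzOnWith'
      (Function.uncurry f) (t' := Ico c 1) Ico_subset_Icc_self
      (closure_Ico hc0.2.ne).ge M.toNNReal ?_ ?_
    · intro t ht
      refine (convex_Icc c 1).lipschitzOnWith_of_nnnorm_hasDerivWithin_le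
        (f' := f' t) (fun x hx => (hf t ht x (hsub hx)).hasDerivWithinAt) fun x hx => ?_
      rw [← norm_toNNReal]
      exact Real.toNNReal_le_toNNReal (hM (t, x) ⟨ht, hx⟩)
    · exact fun x hx => hc x ⟨hc0.1.trans_le hx.1, hx.2⟩
  rintro ⟨t, x⟩ ⟨ht, hx⟩
  have hx0 : 0 < x := hx.1
  have hx1 : x ≤ 1 := hx.2
  have hc0 : x / 2 ∈ Ioo (0:ℝ) 1 := ⟨by linarith, by linarith⟩
  refine (key (x / 2) hc0 (t, x) ⟨ht, by constructor <;> simp only <;> linarith⟩).mono_of_mem_nhdsWithin ?_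
  have : Ioi (x / 2) ∈ 𝓝 x := Ioi_mem_nhds (by linarith)
  rw [mem_nhdsWithin_iff_eventually]
  filter_upwards [prod_mem_nhds univ_mem this] with p hp hp'
  exact ⟨hp'.1, hp.2.le, hp'.2.2⟩

theorem continuousOn_intervalIntegral_of_continuousOn_uncurry (hsT : s ≤ T)
    (hf : ContinuousOn (Function.uncurry f) (Icc s T ×ˢ Ioc (0:ℝ) 1)) :
    ContinuousOn (fun x => ∫ t in s..T, f t x) (Ioc 0 1) := by
  intro x hx
  have hx0 : 0 < x := hx.1
  have hx1 : x ≤ 1 := hx.2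
  have hc1 : x / 2 ≤ 1 := by linarith
  let g : ℝ → ℝ → ℝ := fun z t => f (projIcc s T hsT t) (projIcc (x / 2) 1 hc1 z)
  have hg : Continuous (Function.uncurry g) := by
    refine hf.comp_continuous (f := fun p : ℝ × ℝ =>
      ((projIcc s T hsT p.2 : ℝ), (projIcc (x / 2) 1 hc1 p.1 : ℝ))) (by fun_prop) ?_
    intro p
    exact ⟨(projIcc s T hsT p.2).2, (by linarith : 0 < x / 2).trans_le (projIcc _ _ hc1 p.1).2.1,
      (projIcc _ _ hc1 p.1).2.2⟩
  have hcont := intervalIntegral.continuous_parametric_intervalIntegral_of_continuous'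
    (μ := volume) hg s T
  refine hcont.continuousWithinAt.congr_of_eventuallyEq (f := fun z => ∫ t in s..T, g z t) ?_ ?_
  · have : Ioi (x / 2) ∈ 𝓝 x := Ioi_mem_nhds (by linarith)
    rw [EventuallyEq, eventually_nhdsWithin_iff]
    filter_upwards [this] with z hz hz'
    refine intervalIntegral.integral_congr fun t ht => ?_
    rw [uIcc_of_le hsT] at ht
    simp only [g, projIcc_of_mem hsT ht, projIcc_of_mem hc1 ⟨(mem_Ioi.mp hz).le, hz'.2⟩]
  · refine intervalIntegral.integral_congr fun t ht => ?_
    rw [uIcc_of_le hsT] at ht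
    simp only [g, projIcc_of_mem hsT ht, projIcc_of_mem hc1 ⟨by linarith, hx1⟩]

theorem continuousOn_section {U : Set ℝ}
    (hf : ContinuousOn (Function.uncurry f) (U ×ˢ Ioc (0:ℝ) 1)) {x : ℝ} (hx : x ∈ Ioc (0:ℝ) 1) :
    ContinuousOn (fun t => f t x) U :=
  hf.comp (f := fun t => (t, x)) (by fun_prop) fun _ ht => ⟨ht, hx⟩

theorem hasDerivAt_intervalIntegral_of_continuousOn_uncurry (hsT : s ≤ T)
    (hd : ∀ t ∈ Icc s T, ∀ x ∈ Ioc (0:ℝ) 1, HasDerivAt (f t) (f' t x) x)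
    (hf : ∀ x ∈ Ioo (0:ℝ) 1, ContinuousOn (fun t => f t x) (Icc s T))
    (hf' : ContinuousOn (Function.uncurry f') (Icc s T ×ˢ Ioc (0:ℝ) 1))
    {x : ℝ} (hx : x ∈ Ioo (0:ℝ) 1) :
    HasDerivAt (fun z => ∫ t in s..T, f t z) (∫ t in s..T, f' t x) x := by
  have hx0 : 0 < x := hx.1
  have hx1 : x < 1 := hx.2
  have hsub : Icc (x / 2) 1 ⊆ Ioc (0:ℝ) 1 := fun z hz => ⟨by linarith [hz.1], hz.2⟩
  obtain ⟨M, hM⟩ := (isCompact_Icc.prod isCompact_Icc).exists_bound_of_continuousOn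
    (hf'.mono (prod_mono_right hsub))
  have hI : uIoc s T ⊆ Icc s T := by rw [uIoc_of_le hsT]; exact Ioc_subset_Icc_self
  have hnhds : Icc (x / 2) 1 ∈ 𝓝 x := Icc_mem_nhds (by linarith) hx1
  refine (intervalIntegral.hasDerivAt_integral_of_dominated_loc_of_deriv_le
    (F := fun z t => f t z) (F' := fun z t => f' t z) (bound := fun _ => M)
    hnhds ?_ ?_ ?_ ?_ intervalIntegrable_const ?_).2
  · filter_upwards [Ioo_mem_nhds hx0 hx1] with z hz
    exact ((hf z hz).mono hI).aestronglyMeasurable measurableSet_uIoc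
  · refine ContinuousOn.intervalIntegrable ?_
    rw [uIcc_of_le hsT]
    exact hf x hx
  · exact ((continuousOn_section hf' ⟨hx0, hx1.le⟩).mono hI).aestronglyMeasurable
      measurableSet_uIoc
  · exact Eventually.of_forall fun t ht z hz => hM (t, z) ⟨hI ht, hz⟩
  · exact Eventually.of_forall fun t ht z hz => hd t (hI ht) z (hsub hz)

end Parametric

theorem integrableOn_and_integral_mul_swap {s T M : ℝ} {c : ℝ → ℝ} {G : ℝ → ℝ → ℝ}
    (hc : ContinuousOn c (Ioo 0 1)) (hM : ∀ x ∈ Ioo (0:ℝ) 1, |c x| ≤ M)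
    (hG : IntegrableOn (fun p : ℝ × ℝ => G p.1 p.2) (Ioo s T ×ˢ Ioo (0:ℝ) 1)) :
    IntegrableOn (fun x => c x * ∫ t in Ioo s T, G t x) (Ioo 0 1) ∧
    (∫ t in Ioo s T, ∫ x in Ioo (0:ℝ) 1, c x * G t x) =
      ∫ x in Ioo (0:ℝ) 1, c x * ∫ t in Ioo s T, G t x := by
  have hint : Integrable (Function.uncurry fun t x => c x * G t x)
      ((volume.restrict (Ioo s T)).prod (volume.restrict (Ioo (0:ℝ) 1))) := by
    rw [Measure.prod_restrict, ← Measure.volume_eq_prod]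
    refine Integrable.bdd_mul (f := fun p : ℝ × ℝ => c p.2) (c := M) hG ?_ ?_
    · rw [Measure.volume_eq_prod, ← Measure.prod_restrict]
      exact (hc.aestronglyMeasurable measurableSet_Ioo).comp_snd
    · exact (ae_restrict_iff' (measurableSet_Ioo.prod measurableSet_Ioo)).mpr
        (Eventually.of_forall fun p hp => hM p.2 hp.2)
  refine ⟨?_, ?_⟩
  · simpa only [Function.uncurry, integral_const_mul, IntegrableOn] using hint.integral_prod_right
  · simpa only [integral_const_mul] using integral_integral_swap hint

section Coefficients

variable {a a' b : ℝ → ℝ} {K : ℝ}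

theorem HypH1.pos (h : HypH1 a a' b K) {x : ℝ} (hx : x ∈ Ioc (0:ℝ) 1) : 0 < a x := by
  rcases h.1 with h | h
  · exact h.2.2.1 x hx
  · exact h.2.2.1 x hx

theorem HypH1.continuousOn (h : HypH1 a a' b K) : ContinuousOn a (Icc 0 1) := by
  rcases h.1 with h | h
  · exact h.1
  · exact h.1

theorem HypH1.hasDerivAt (h : HypH1 a a' b K) {x : ℝ} (hx : x ∈ Ioo (0:ℝ) 1) :
    HasDerivAt a (a' x) x := by
  rcases h.1 with h | h
  · exact h.2.2.2.1 x ⟨hx.1, hx.2.le⟩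
  · exact (h.2.2.2.1 x ⟨hx.1.le, hx.2.le⟩).hasDerivAt (Icc_mem_nhds hx.1 hx.2)

theorem HypH1.continuousOn_deriv (h : HypH1 a a' b K) : ContinuousOn a' (Ioc 0 1) := by
  rcases h.1 with h | h
  · exact h.2.2.2.2.1
  · exact h.2.2.2.2.1.mono Ioc_subset_Icc_self

theorem HypH1.deriv_bound (h : HypH1 a a' b K) {x : ℝ} (hx : x ∈ Ioc (0:ℝ) 1) :
    x * |a' x| / a x ≤ K := by
  rcases h.1 with h | h
  · exact h.2.2.2.2.2.1.1 (mem_image_of_mem _ hx)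
  · exact h.2.2.2.2.2.1.1 (mem_image_of_mem _ hx)

theorem HypH1.lt_two (h : HypH1 a a' b K) : K < 2 := by
  rcases h.1 with h | h
  · linarith [h.2.2.2.2.2.2.2]
  · exact h.2.2.2.2.2.2.2

theorem HypH1.mul_pow_le (h : HypH1 a a' b K) {n : ℕ} (hn : K ≤ n) {x : ℝ}
    (hx : x ∈ Ioc (0:ℝ) 1) : a 1 * x ^ n ≤ a x := by
  have hanti : AntitoneOn (fun z => a z / z ^ n) (Ioc 0 1) := by
    refine antitoneOn_of_hasDerivWithinAt_nonpos (convex_Ioc 0 1)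
      (f' := fun z => (a' z * z ^ n - a z * (n * z ^ (n - 1))) / (z ^ n) ^ 2) ?_ ?_ ?_
    · exact (h.continuousOn.mono Ioc_subset_Icc_self).div (by fun_prop)
        fun z hz => (pow_pos hz.1 n).ne'
    · intro z hz
      rw [interior_Ioc] at hz
      exact ((h.hasDerivAt hz).div (hasDerivAt_pow n z) (pow_pos hz.1 n).ne').hasDerivWithinAt
    · intro z hz
      rw [interior_Ioc] at hz
      have hz0 : 0 < z := hz.1
      have hz' : z ∈ Ioc (0:ℝ) 1 := ⟨hz.1, hz.2.le⟩
      have hb := (h.deriv_bound hz').trans hn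
      rw [div_le_iff₀ (h.pos hz')] at hb
      refine div_nonpos_of_nonpos_of_nonneg ?_ (by positivity)
      rcases Nat.eq_zero_or_pos n with rfl | hn0
      · have : z * |a' z| ≤ 0 := by simpa using hb
        have : |a' z| ≤ 0 := nonpos_of_mul_nonpos_right this hz0
        simpa using (le_abs_self _).trans this
      · rw [← Nat.sub_add_cancel hn0, pow_succ, Nat.add_sub_cancel, Nat.sub_add_cancel hn0]
        have h1 : z * a' z ≤ n * a z :=
          (mul_le_mul_of_nonneg_left (le_abs_self _) hz0.le).trans hb
        have h2 : 0 < z ^ (n - 1) := by positivity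
        nlinarith
  have := hanti hx ⟨one_pos, le_rfl⟩ hx.2
  simp only [one_pow, div_one] at this
  rwa [le_div_iff₀ (pow_pos hx.1 n)] at this

theorem HypH1.exists_bound_drift (h : HypH1 a a' b K) :
    ∃ M : ℝ, ∀ x ∈ Ioo (0:ℝ) 1, |x * b x / a x| ≤ M := by
  rcases lt_or_ge 1 K with hK | hK
  · exact h.2.2.2 hK
  obtain ⟨B, hB⟩ := isCompact_Icc.exists_bound_of_continuousOn h.2.1
  refine ⟨B / a 1, fun x hx => ?_⟩
  have hx' : x ∈ Ioc (0:ℝ) 1 := ⟨hx.1, hx.2.le⟩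
  have h1 := h.mul_pow_le (n := 1) (by simpa using hK) hx'
  have ha1 : 0 < a 1 := h.pos ⟨one_pos, le_rfl⟩
  have hbx : |b x| ≤ B := hB x ⟨hx.1.le, hx.2.le⟩
  have hB0 : 0 ≤ B := (abs_nonneg _).trans hbx
  rw [abs_div, abs_mul, abs_of_pos hx.1, abs_of_pos (h.pos hx'), div_le_div_iff₀ (h.pos hx') ha1]
  rw [pow_one] at h1
  have hx0 : 0 < x := hx.1
  calc x * |b x| * a 1 = |b x| * (a 1 * x) := by ring
    _ ≤ B * a x := by gcongr

theorem HypH1.intervalIntegrable (h : HypH1 a a' b K) {x y : ℝ} (hx : x ∈ Icc (0:ℝ) 1)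
    (hy : y ∈ Icc (0:ℝ) 1) : IntervalIntegrable (fun z => b z / a z) volume x y := by
  have : IntegrableOn (fun z => b z / a z) (Icc 0 1) := by
    rw [integrableOn_Icc_iff_integrableOn_Ioo]
    exact h.2.2.1
  exact (this.mono_set (uIcc_subset_Icc hx hy)).intervalIntegrable

theorem HypH1.continuousOn_ratio (h : HypH1 a a' b K) :
    ContinuousOn (fun z => b z / a z) (Ioc 0 1) :=
  (h.2.1.mono Ioc_subset_Icc_self).div (h.continuousOn.mono Ioc_subset_Icc_self)
    fun _ hz => (h.pos hz).ne'

theorem HypH1.continuousOn_etaW (h : HypH1 a a' b K) : ContinuousOn (etaW a b) (Icc 0 1) := by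
  have h1 := intervalIntegral.continuousOn_primitive_interval' (a := 1 / 2)
    (h.intervalIntegrable (left_mem_Icc.mpr zero_le_one) (right_mem_Icc.mpr zero_le_one))
    (by rw [uIcc_of_le zero_le_one]; constructor <;> norm_num)
  rw [uIcc_of_le zero_le_one] at h1
  exact Real.continuous_exp.comp_continuousOn h1

theorem etaW_pos (a b : ℝ → ℝ) (x : ℝ) : 0 < etaW a b x := Real.exp_pos _

theorem HypH1.hasDerivAt_etaW (h : HypH1 a a' b K) {x : ℝ} (hx : x ∈ Ioo (0:ℝ) 1) :
    HasDerivAt (etaW a b) (etaW a b x * (b x / a x)) x := by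
  have hc : ContinuousOn (fun z => b z / a z) (Ioo 0 1) :=
    h.continuousOn_ratio.mono Ioo_subset_Ioc_self
  have hmem : Ioo (0:ℝ) 1 ∈ 𝓝 x := Ioo_mem_nhds hx.1 hx.2
  exact (intervalIntegral.integral_hasDerivAt_right
    (h.intervalIntegrable (by constructor <;> norm_num) ⟨hx.1.le, hx.2.le⟩)
    (hc.stronglyMeasurableAtFilter isOpen_Ioo x hx) (hc.continuousAt hmem)).exp

theorem HypH1.hasDerivAt_id_div_sigW (h : HypH1 a a' b K) {x : ℝ} (hx : x ∈ Ioo (0:ℝ) 1) :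
    HasDerivAt (fun z => z / sigW a b z)
      ((1 - x * (a' x - b x) / a x) * (1 / sigW a b x)) x := by
  have ha := h.pos ⟨hx.1, hx.2.le⟩
  have hη := etaW_pos a b x
  have hσ : sigW a b x ≠ 0 := (div_pos ha hη).ne'
  refine ((hasDerivAt_id x).div ((h.hasDerivAt hx).div (h.hasDerivAt_etaW hx) hη.ne') hσ).congr_deriv
    ?_
  simp only [id, sigW, Pi.div_apply]
  field_simp

theorem HypH1.continuousOn_sigW (h : HypH1 a a' b K) : ContinuousOn (sigW a b) (Ioc 0 1) :=
  (h.continuousOn.mono Ioc_subset_Icc_self).div (h.continuousOn_etaW.mono Ioc_subset_Icc_self)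
    fun x _ => (etaW_pos a b x).ne'

theorem HypH1.sigW_pos (h : HypH1 a a' b K) {x : ℝ} (hx : x ∈ Ioc (0:ℝ) 1) : 0 < sigW a b x :=
  div_pos (h.pos hx) (etaW_pos a b x)

theorem HypH1.integrableOn_cross (h : HypH1 a a' b K) {u v : ℝ → ℝ}
    (hu : ContinuousOn u (Ioo 0 1)) (hv : ContinuousOn v (Ioo 0 1))
    (hui : IntegrableOn (fun x => (u x) ^ 2) (Ioo 0 1))
    (hvi : IntegrableOn (fun x => (v x) ^ 2 / sigW a b x) (Ioo 0 1)) :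
    IntegrableOn (fun x => x * u x * v x / sigW a b x) (Ioo 0 1) := by
  obtain ⟨C, hC⟩ := isCompact_Icc.exists_bound_of_continuousOn h.continuousOn_etaW
  refine Integrable.mono' ((hui.const_mul (C / a 1)).add hvi) ?_ ?_
  · refine ContinuousOn.aestronglyMeasurable ?_ measurableSet_Ioo
    exact ((continuousOn_id.mul hu).mul hv).div (h.continuousOn_sigW.mono Ioo_subset_Ioc_self)
      fun x hx => (h.sigW_pos ⟨hx.1, hx.2.le⟩).ne'
  · refine (ae_restrict_iff' measurableSet_Ioo).mpr (Eventually.of_forall fun x hx => ?_)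
    have hx' : x ∈ Ioc (0:ℝ) 1 := ⟨hx.1, hx.2.le⟩
    have hσ := h.sigW_pos hx'
    have ha1 : 0 < a 1 := h.pos ⟨one_pos, le_rfl⟩
    have hη := etaW_pos a b x
    have h2 : x ^ 2 ≤ C / a 1 * sigW a b x := by
      have h3 := h.mul_pow_le (n := 2) (by exact_mod_cast h.lt_two.le) hx'
      have h4 : etaW a b x ≤ C := (le_abs_self _).trans (hC x ⟨hx.1.le, hx.2.le⟩)
      have h5 : a x = etaW a b x * sigW a b x := by rw [sigW]; field_simp
      rw [div_mul_eq_mul_div, le_div_iff₀ ha1]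
      calc x ^ 2 * a 1 = a 1 * x ^ 2 := mul_comm _ _
        _ ≤ etaW a b x * sigW a b x := h5 ▸ h3
        _ ≤ C * sigW a b x := by gcongr
    simp only [Pi.add_apply]
    rw [Real.norm_eq_abs, abs_div, abs_of_pos hσ, div_le_iff₀ hσ, add_mul, div_mul_cancel₀ _ hσ.ne']
    have h6 : |x * u x * v x| ≤ (x * u x) ^ 2 + (v x) ^ 2 := by
      rw [abs_le]
      constructor <;> nlinarith [sq_nonneg (x * u x + v x), sq_nonneg (x * u x - v x)]
    have h7 : (x * u x) ^ 2 ≤ C / a 1 * sigW a b x * (u x) ^ 2 := by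
      rw [mul_pow]; gcongr
    linarith

end Coefficients

theorem ClassicalSol.hasDerivAt_yx {a b : ℝ → ℝ} {β : ℝ} {y yt yx ytt ytx yxx : ℝ → ℝ → ℝ}
    (hy : ClassicalSol a b β y yt yx ytt ytx yxx) {t x : ℝ} (ht : 0 < t)
    (hx : x ∈ Ioo (0:ℝ) 1) : HasDerivAt (fun r => yx r x) (ytx t x) t := by
  have hx' : x ∈ Ioc (0:ℝ) 1 := ⟨hx.1, hx.2.le⟩
  have hcont : ∀ z ∈ Ioo (0:ℝ) 1, ContinuousOn (fun r => yt r z) (Ici 0) := fun z hz r hr =>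
    (hy.dtt r z hr ⟨hz.1.le, hz.2.le⟩).continuousAt.continuousWithinAt
  have hsub : ∀ r : ℝ, Icc 0 r ⊆ Ici 0 := fun r => Icc_subset_Ici_self
  have key : ∀ r : ℝ, 0 ≤ r → yx r x = yx 0 x + ∫ τ in (0:ℝ)..r, ytx τ x := by
    intro r hr
    have h1 := hasDerivAt_intervalIntegral_of_continuousOn_uncurry hr
      (fun τ hτ z hz => hy.dtx τ z hτ.1 hz) (fun z hz => (hcont z hz).mono (hsub r))
      (hy.cont_tx.mono (prod_mono_left (hsub r))) hx
    have h2 : HasDerivAt (fun z => y r z - y 0 z) (∫ τ in (0:ℝ)..r, ytx τ x) x := by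
      refine h1.congr_of_eventuallyEq ?_
      filter_upwards [Ioo_mem_nhds hx.1 hx.2] with z hz
      refine (intervalIntegral.integral_eq_sub_of_hasDerivAt (f := fun τ => y τ z)
        (f' := fun τ => yt τ z) (fun τ hτ => ?_) ?_).symm
      · rw [uIcc_of_le hr] at hτ
        exact hy.dt τ z hτ.1 ⟨hz.1.le, hz.2.le⟩
      · refine ContinuousOn.intervalIntegrable ?_
        rw [uIcc_of_le hr]
        exact (hcont z hz).mono (hsub r)
    have h3 := h2.unique ((hy.dx r x hr hx').sub (hy.dx 0 x le_rfl hx'))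
    linarith
  have hc : ContinuousOn (fun τ => ytx τ x) (Ici 0) := continuousOn_section hy.cont_tx hx'
  have hii : IntervalIntegrable (fun τ => ytx τ x) volume 0 t := by
    refine ContinuousOn.intervalIntegrable ?_
    rw [uIcc_of_le ht.le]
    exact hc.mono (hsub t)
  have hd := (intervalIntegral.integral_hasDerivAt_right hii
    ((hc.mono Ioi_subset_Ici_self).stronglyMeasurableAtFilter isOpen_Ioi t ht)
    (hc.continuousAt (Ici_mem_nhds ht))).const_add (yx 0 x)
  refine hd.congr_of_eventuallyEq ?_
  filter_upwards [Ioi_mem_nhds ht] with r hr using key r (le_of_lt hr)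

section Solution

variable {a a' b : ℝ → ℝ} {K β : ℝ} {y yt yx ytt ytx yxx : ℝ → ℝ → ℝ} {s T : ℝ}

theorem ClassicalSol.continuousOn_yt (hy : ClassicalSol a b β y yt yx ytt ytx yxx) (hs : 0 < s) :
    ContinuousOn (Function.uncurry yt) (Icc s T ×ˢ Ioc (0:ℝ) 1) := by
  have hsub : Icc s T ⊆ Ici 0 := fun t ht => hs.le.trans ht.1
  exact continuousOn_uncurry_of_hasDerivAt (fun t ht x hx => hy.dtx t x (hsub ht) hx)
    (hy.cont_tx.mono (prod_mono_left hsub)) fun x hx t ht =>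
      (hy.dtt t x (hsub ht) ⟨hx.1.le, hx.2.le⟩).continuousAt.continuousWithinAt

theorem ClassicalSol.continuousOn_yx (hy : ClassicalSol a b β y yt yx ytt ytx yxx) (hs : 0 < s) :
    ContinuousOn (Function.uncurry yx) (Icc s T ×ˢ Ioc (0:ℝ) 1) := by
  have hsub : Icc s T ⊆ Ici 0 := fun t ht => hs.le.trans ht.1
  exact continuousOn_uncurry_of_hasDerivAt (fun t ht x hx => hy.dxx t x (hsub ht) hx)
    (hy.cont_xx.mono (prod_mono_left hsub)) fun x hx t ht =>
      (hy.hasDerivAt_yx (hs.trans_le ht.1) hx).continuousAt.continuousWithinAt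

theorem hasDerivAt_intervalIntegral_sq {f f' : ℝ → ℝ → ℝ} (hsT : s ≤ T)
    (hd : ∀ t ∈ Icc s T, ∀ x ∈ Ioc (0:ℝ) 1, HasDerivAt (f t) (f' t x) x)
    (hf : ContinuousOn (Function.uncurry f) (Icc s T ×ˢ Ioc (0:ℝ) 1))
    (hf' : ContinuousOn (Function.uncurry f') (Icc s T ×ˢ Ioc (0:ℝ) 1))
    {x : ℝ} (hx : x ∈ Ioo (0:ℝ) 1) :
    HasDerivAt (fun z => ∫ t in s..T, f t z ^ 2) (2 * ∫ t in s..T, f t x * f' t x) x := by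
  have h := hasDerivAt_intervalIntegral_of_continuousOn_uncurry (f := fun t x => f t x ^ 2)
    (f' := fun t x => 2 * (f t x * f' t x)) hsT
    (fun t ht x hx => ((hd t ht x hx).pow 2).congr_deriv (by norm_num; ring))
    (fun x hx => (continuousOn_section hf ⟨hx.1, hx.2.le⟩).pow 2)
    ((hf.mul hf').const_mul 2) hx
  rwa [intervalIntegral.integral_const_mul] at h

theorem ClassicalSol.time_boundary_eq
    (hy : ClassicalSol a b β y yt yx ytt ytx yxx) (hs : 0 < s) (hsT : s ≤ T) {x : ℝ}
    (hx : x ∈ Ioo (0:ℝ) 1) :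
    yx T x * yt T x - yx s x * yt s x =
      (∫ t in s..T, yt t x * ytx t x) + a x * (∫ t in s..T, yx t x * yxx t x)
        + b x * ∫ t in s..T, yx t x ^ 2 := by
  have hx' : x ∈ Ioc (0:ℝ) 1 := ⟨hx.1, hx.2.le⟩
  have hsub : Icc s T ⊆ Ici 0 := fun t ht => hs.le.trans ht.1
  have cyt := continuousOn_section (hy.continuousOn_yt (T := T) hs) hx'
  have cyx := continuousOn_section (hy.continuousOn_yx (T := T) hs) hx'
  have cytx := (continuousOn_section hy.cont_tx hx').mono hsub
  have cyxx := (continuousOn_section hy.cont_xx hx').mono hsub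
  have ii : ∀ {g : ℝ → ℝ}, ContinuousOn g (Icc s T) → IntervalIntegrable g volume s T := by
    intro g hg
    rw [← uIcc_of_le hsT] at hg
    exact hg.intervalIntegrable
  have i1 : IntervalIntegrable (fun t => yt t x * ytx t x) volume s T := ii (cyt.mul cytx)
  have i2 : IntervalIntegrable (fun t => a x * (yx t x * yxx t x)) volume s T :=
    (ii (cyx.mul cyxx)).const_mul _
  have i3 : IntervalIntegrable (fun t => b x * yx t x ^ 2) volume s T :=
    (ii (cyx.pow 2)).const_mul _
  rw [← intervalIntegral.integral_const_mul, ← intervalIntegral.integral_const_mul,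
    ← intervalIntegral.integral_add i1 i2, ← intervalIntegral.integral_add (i1.add i2) i3]
  symm
  refine intervalIntegral.integral_eq_sub_of_hasDerivAt (f := fun t => yx t x * yt t x)
    (fun t ht => ?_) ((i1.add i2).add i3)
  rw [uIcc_of_le hsT] at ht
  have ht0 : 0 < t := hs.trans_le ht.1
  refine ((hy.hasDerivAt_yx ht0 hx).mul (hy.dtt t x ht0.le ⟨hx.1.le, hx.2.le⟩)).congr_deriv ?_
  rw [hy.pde t x ht0 hx]
  ring

theorem ClassicalSol.integrableOn_cross (hH1 : HypH1 a a' b K)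
    (hy : ClassicalSol a b β y yt yx ytt ytx yxx) {t : ℝ} (ht : 0 ≤ t) :
    IntegrableOn (fun x => x * yx t x * yt t x / sigW a b x) (Ioo 0 1) :=
  hH1.integrableOn_cross
    (fun x hx => (hy.dxx t x ht ⟨hx.1, hx.2.le⟩).continuousAt.continuousWithinAt)
    (fun x hx => (hy.dtx t x ht ⟨hx.1, hx.2.le⟩).continuousAt.continuousWithinAt)
    (hy.regx t ht).deriv_sq_int (hy.regt t ht).l2sig.2

end Solution

/-- The multiplier identity of Proposition 3.2 (multiplier `x y_x / σ`). -/
theorem stmt14 (a a' b : ℝ → ℝ) (K β : ℝ) (y yt yx ytt ytx yxx : ℝ → ℝ → ℝ)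
    (hH1 : HypH1 a a' b K) (hβ : 0 ≤ β)
    (hy : ClassicalSol a b β y yt yx ytt ytx yxx) :
    ∀ s T : ℝ, 0 < s → s < T →
      0 = 2 * (∫ x in Set.Ioo (0:ℝ) 1,
            (x * yx T x * yt T x / sigW a b x - x * yx s x * yt s x / sigW a b x))
          - (1 / sigW a b 1) * (∫ t in Set.Ioo s T, (yt t 1) ^ 2)
          - etaW a b 1 * (∫ t in Set.Ioo s T, (yx t 1) ^ 2)
          - (∫ t in Set.Ioo s T, ∫ x in Set.Ioo (0:ℝ) 1,
              x * etaW a b x * (b x / a x) * (yx t x) ^ 2)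
          + (∫ t in Set.Ioo s T, ∫ x in Set.Ioo (0:ℝ) 1,
              (1 - x * (a' x - b x) / a x) * (1 / sigW a b x) * (yt t x) ^ 2)
          + (∫ t in Set.Ioo s T, ∫ x in Set.Ioo (0:ℝ) 1,
              etaW a b x * (yx t x) ^ 2) := by

  intro s T hs hsT
  have hsT' := hsT.le
  have hsub : Icc s T ⊆ Ici 0 := fun t ht => hs.le.trans ht.1
  have cyt := hy.continuousOn_yt (T := T) hs
  have cyx := hy.continuousOn_yx (T := T) hs
  obtain ⟨hi1, hi2⟩ := hy.intQ s T hs hsT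
  obtain ⟨M, hM⟩ := hH1.exists_bound_drift
  have hcb : ContinuousOn (fun x => x * b x / a x) (Ioo 0 1) :=
    ((continuousOn_id.mul hH1.continuousOn_ratio).mono Ioo_subset_Ioc_self).congr
      fun x _ => mul_div_assoc x (b x) (a x)
  have hca : ContinuousOn (fun x => x * a' x / a x) (Ioo 0 1) :=
    ((continuousOn_id.mul hH1.continuousOn_deriv).div
      (hH1.continuousOn.mono Ioc_subset_Icc_self) fun x hx => (hH1.pos hx).ne').mono
      Ioo_subset_Ioc_self
  have hcc : ContinuousOn (fun x => 1 - x * (a' x - b x) / a x) (Ioo 0 1) :=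
    (((continuousOn_const (c := (1:ℝ))).sub hca).add hcb).congr fun x _ => by
      simp only [Pi.add_apply, Pi.sub_apply]
      ring
  have hMc : ∀ x ∈ Ioo (0:ℝ) 1, |1 - x * (a' x - b x) / a x| ≤ 1 + K + M := by
    intro x hx
    have hx' : x ∈ Ioc (0:ℝ) 1 := ⟨hx.1, hx.2.le⟩
    have h1 : |x * a' x / a x| ≤ K := by
      rw [abs_div, abs_mul, abs_of_pos hx.1, abs_of_pos (hH1.pos hx')]
      exact hH1.deriv_bound hx'
    have h2 := hM x hx
    rw [abs_le] at h1 h2 ⊢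
    have h3 : 1 - x * (a' x - b x) / a x = 1 - x * a' x / a x + x * b x / a x := by ring
    rw [h3]
    constructor <;> linarith [h1.1, h1.2, h2.1, h2.2]
  have hone : ∀ x ∈ Ioo (0:ℝ) 1, |(1:ℝ)| ≤ 1 := fun _ _ => abs_one.le
  have F1 := integrableOn_and_integral_mul_swap (G := fun t x => yt t x ^ 2 / sigW a b x) hcc hMc hi1
  have F2 := integrableOn_and_integral_mul_swap (G := fun t x => etaW a b x * yx t x ^ 2) hcb hM hi2
  have F3 := integrableOn_and_integral_mul_swap (G := fun t x => etaW a b x * yx t x ^ 2)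
    continuousOn_const hone hi2
  have F4 := integrableOn_and_integral_mul_swap (G := fun t x => yt t x ^ 2 / sigW a b x)
    continuousOn_const hone hi1
  simp only [one_mul] at F3 F4
  have key := eq_setIntegral_of_integrableOn_div
    (h := fun x => x / sigW a b x * (∫ t in s..T, yt t x ^ 2)
      + x * etaW a b x * ∫ t in s..T, yx t x ^ 2)
    (q := fun x => 2 * (x * yx T x * yt T x / sigW a b x - x * yx s x * yt s x / sigW a b x)
      - (x * b x / a x) * (∫ t in Ioo s T, etaW a b x * yx t x ^ 2)
      + (1 - x * (a' x - b x) / a x) * (∫ t in Ioo s T, yt t x ^ 2 / sigW a b x)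
      + ∫ t in Ioo s T, etaW a b x * yx t x ^ 2) ?_ ?_ ?_ ?_
  · have hcross := ((hy.integrableOn_cross hH1 (hs.trans hsT).le).sub
      (hy.integrableOn_cross hH1 hs.le)).const_mul 2
    rw [integral_add, integral_add, integral_sub, integral_const_mul, ← F1.2, ← F2.2, ← F3.2] at key
    rotate_left
    · exact hcross
    · exact F2.1
    · exact hcross.sub F2.1
    · exact F1.1
    · exact (hcross.sub F2.1).add F1.1
    · exact F3.1
    simp only [one_mul, intervalIntegral.integral_of_le hsT', integral_Ioc_eq_integral_Ioo] at key
    have e1 : (∫ t in Ioo s T, ∫ x in Ioo (0:ℝ) 1, x * etaW a b x * (b x / a x) * yx t x ^ 2)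
        = ∫ t in Ioo s T, ∫ x in Ioo (0:ℝ) 1, x * b x / a x * (etaW a b x * yx t x ^ 2) := by
      congr! 4
      ring
    have e2 : (∫ t in Ioo s T, ∫ x in Ioo (0:ℝ) 1,
          (1 - x * (a' x - b x) / a x) * (1 / sigW a b x) * yt t x ^ 2)
        = ∫ t in Ioo s T, ∫ x in Ioo (0:ℝ) 1,
          (1 - x * (a' x - b x) / a x) * (yt t x ^ 2 / sigW a b x) := by
      congr! 4
      ring
    rw [e1, e2]
    linarith
  · exact ((continuousOn_id.div hH1.continuousOn_sigW fun x hx => (hH1.sigW_pos hx).ne').mul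
      (continuousOn_intervalIntegral_of_continuousOn_uncurry (f := fun t x => yt t x ^ 2) hsT'
        ((continuous_pow 2).comp_continuousOn cyt))).add
      ((continuousOn_id.mul (hH1.continuousOn_etaW.mono Ioc_subset_Icc_self)).mul
        (continuousOn_intervalIntegral_of_continuousOn_uncurry (f := fun t x => yx t x ^ 2) hsT'
          ((continuous_pow 2).comp_continuousOn cyx)))
  · intro x hx
    have hA := hasDerivAt_intervalIntegral_sq hsT' (fun t ht z hz => hy.dtx t z (hsub ht) hz) cyt
      (hy.cont_tx.mono (prod_mono_left hsub)) hx
    have hD := hasDerivAt_intervalIntegral_sq hsT' (fun t ht z hz => hy.dxx t z (hsub ht) hz) cyx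
      (hy.cont_xx.mono (prod_mono_left hsub)) hx
    refine (((hH1.hasDerivAt_id_div_sigW hx).mul hA).add
      (((hasDerivAt_id x).mul (hH1.hasDerivAt_etaW hx)).mul hD)).congr_deriv ?_
    have hbd := hy.time_boundary_eq hs hsT' hx
    have ha := (hH1.pos ⟨hx.1, hx.2.le⟩).ne'
    have hη := (etaW_pos a b x).ne'
    have e : x * yx T x * yt T x / sigW a b x - x * yx s x * yt s x / sigW a b x
        = x / sigW a b x * (yx T x * yt T x - yx s x * yt s x) := by ring
    rw [e, hbd, integral_const_mul, integral_div, ← integral_Ioc_eq_integral_Ioo,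
      ← integral_Ioc_eq_integral_Ioo, ← intervalIntegral.integral_of_le hsT',
      ← intervalIntegral.integral_of_le hsT']
    simp only [id, sigW, Pi.mul_apply]
    field_simp
    ring
  · have hcross := ((hy.integrableOn_cross hH1 (hs.trans hsT).le).sub
      (hy.integrableOn_cross hH1 hs.le)).const_mul 2
    exact ((hcross.sub F2.1).add F1.1).add F3.1
  · refine (F4.1.add F3.1).congr_fun (fun x hx => ?_) measurableSet_Ioo
    have hx0 : x ≠ 0 := hx.1.ne'
    simp only [Pi.add_apply]
    rw [integral_const_mul, integral_div, ← integral_Ioc_eq_integral_Ioo,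
      ← integral_Ioc_eq_integral_Ioo, ← intervalIntegral.integral_of_le hsT',
      ← intervalIntegral.integral_of_le hsT']
    field_simp
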